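/- arXiv:2401.06989 — 4 statements merged into one kernel-verified Lean document; each statement's English description precedes it below -/
import Mathlib

section
/- Let H be a real inner product space, let h : H → ℝ be differentiable with gradient ∇h, let β > 0 and μ ≥ 0. Assume h is β-smooth, i.e. ‖∇h(u) − ∇h(v)‖ ≤ β‖u − v‖ for all u, v ∈ H, and μ-strongly convex, i.e. h(v) ≥ h(u) + ⟪∇h(u), v − u⟫ + (μ/2)‖v − u‖² for all u, v ∈ H. Then for all x, y, z ∈ H: ⟪∇h(x), z − y⟫ ≥ h(z) − h(y) + (μ/4)‖y − z‖² − β‖z − x‖². -/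
open RealInnerProductSpace

/-- Perturbed strong convexity (paper's Lemma 1). -/
theorem perturbed_strong_convexity
    {H : Type*} [NormedAddCommGroup H] [InnerProductSpace ℝ H] [CompleteSpace H]
    (h : H → ℝ) (h' : H → H) (β μ : ℝ) (hβ : 0 < β) (hμ : 0 ≤ μ)
    (hdiff : ∀ x, HasGradientAt h (h' x) x)
    (hsmooth : ∀ u v, ‖h' u - h' v‖ ≤ β * ‖u - v‖)
    (hsconv : ∀ u v, h u + ⟪h' u, v - u⟫ + μ / 2 * ‖v - u‖ ^ 2 ≤ h v)
    (x y z : H) :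
    h z - h y + μ / 4 * ‖y - z‖ ^ 2 - β * ‖z - x‖ ^ 2 ≤ ⟪h' x, z - y⟫ := by
  have h1 := hsconv z x
  have h2 := hsconv x y
  have h3 : ⟪h' z - h' x, z - x⟫ ≤ β * ‖z - x‖ ^ 2 := by
    have a := real_inner_le_norm (h' z - h' x) (z - x)
    have b := mul_le_mul_of_nonneg_right (hsmooth z x) (norm_nonneg (z - x))
    nlinarith
  have h4 : ‖y - z‖ ^ 2 ≤ 2 * ‖y - x‖ ^ 2 + 2 * ‖z - x‖ ^ 2 := by
    have a : ‖y - z‖ ≤ ‖y - x‖ + ‖z - x‖ := by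
      rw [norm_sub_rev z x]
      exact norm_sub_le_norm_sub_add_norm_sub y x z
    nlinarith [norm_nonneg (y - z), sq_nonneg (‖y - x‖ - ‖z - x‖)]
  have h5 := mul_le_mul_of_nonneg_left h4 hμ
  rw [norm_sub_rev x z] at h1
  simp only [inner_sub_left, inner_sub_right] at *
  linarith
end

section
/- Let H be a real inner product space, let N, E ≥ 1 be natural numbers, β > 0, μ ≥ 0, and for i = 1, …, N let ℓᵢ : H → ℝ be differentiable, β-smooth (gradient β-Lipschitz) and μ-strongly convex. Let θ, θ* ∈ H and let θ_{i,k} ∈ H for i = 1, …, N and k = 0, …, E−1 be arbitrary points. Then (1/(EN)) ∑_{k=0}^{E−1} ∑_{i=1}^{N} ⟪∇ℓᵢ(θ_{i,k}), θ* − θ⟫ ≤ −( (1/N)∑_{i=1}^N (ℓᵢ(θ) − ℓᵢ(θ*)) + (μ/4)‖θ − θ*‖² ) + β · (1/(EN)) ∑_{k=0}^{E−1} ∑_{i=1}^{N} ‖θ_{i,k} − θ‖². -/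
open RealInnerProductSpace

/-- Perturbed strong convexity. -/
theorem perturbed_sconv {H : Type*} [NormedAddCommGroup H] [InnerProductSpace ℝ H]
    (β μ : ℝ) (hμ : 0 ≤ μ) (f : H → ℝ) (g : H → H)
    (hs : ∀ u v, ‖g u - g v‖ ≤ β * ‖u - v‖)
    (hc : ∀ u v, f u + ⟪g u, v - u⟫ + μ / 2 * ‖v - u‖ ^ 2 ≤ f v) (x y z : H) :
    ⟪g x, z - y⟫ ≤ -((f y - f z) + μ / 4 * ‖y - z‖ ^ 2) + β * ‖x - y‖ ^ 2 := by
  have h1 := hc x z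
  have h2 := hc y x
  have h3 : ⟪g x - g y, x - y⟫ ≤ β * ‖x - y‖ ^ 2 := by
    calc ⟪g x - g y, x - y⟫ ≤ ‖g x - g y‖ * ‖x - y‖ := real_inner_le_norm _ _
      _ ≤ (β * ‖x - y‖) * ‖x - y‖ := by gcongr; exact hs x y
      _ = _ := by ring
  have h4 : ⟪g x, z - y⟫ = ⟪g x, z - x⟫ + ⟪g x - g y, x - y⟫ + ⟪g y, x - y⟫ := by
    simp only [inner_sub_left, inner_sub_right]; ring
  have h5 : ‖y - z‖ ^ 2 ≤ 2 * ‖z - x‖ ^ 2 + 2 * ‖x - y‖ ^ 2 := by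
    have h : ‖y - z‖ ≤ ‖z - x‖ + ‖x - y‖ := by
      rw [norm_sub_rev y z]; exact norm_sub_le_norm_sub_add_norm_sub _ _ _
    nlinarith [norm_nonneg (y - z), sq_nonneg (‖z - x‖ - ‖x - y‖)]
  nlinarith [mul_le_mul_of_nonneg_left h5 hμ]

/-- Bound on term A1 in the one-round-progress theorem: averaging
perturbed strong convexity over clients and local steps. -/
theorem A1_bound
    {H : Type*} [NormedAddCommGroup H] [InnerProductSpace ℝ H] [CompleteSpace H]
    (N E : ℕ) (hN : 1 ≤ N) (hE : 1 ≤ E) (β μ : ℝ) (hβ : 0 < β) (hμ : 0 ≤ μ)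
    (ℓ : Fin N → H → ℝ) (ℓ' : Fin N → H → H)
    (hdiff : ∀ i x, HasGradientAt (ℓ i) (ℓ' i x) x)
    (hsmooth : ∀ i u v, ‖ℓ' i u - ℓ' i v‖ ≤ β * ‖u - v‖)
    (hsconv : ∀ i u v, ℓ i u + ⟪ℓ' i u, v - u⟫ + μ / 2 * ‖v - u‖ ^ 2 ≤ ℓ i v)
    (θ θstar : H) (θloc : Fin N → Fin E → H) :
    (1 / ((E : ℝ) * N)) * ∑ k : Fin E, ∑ i : Fin N, ⟪ℓ' i (θloc i k), θstar - θ⟫ ≤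
      -((1 / (N : ℝ)) * ∑ i : Fin N, (ℓ i θ - ℓ i θstar) + μ / 4 * ‖θ - θstar‖ ^ 2)
      + β * ((1 / ((E : ℝ) * N)) * ∑ k : Fin E, ∑ i : Fin N, ‖θloc i k - θ‖ ^ 2) := by
  have hN' : (0 : ℝ) < N := by exact_mod_cast hN
  have hE' : (0 : ℝ) < E := by exact_mod_cast hE
  have key : ∑ k : Fin E, ∑ i : Fin N, ⟪ℓ' i (θloc i k), θstar - θ⟫ ≤
      ∑ k : Fin E, ∑ i : Fin N, (-((ℓ i θ - ℓ i θstar) + μ / 4 * ‖θ - θstar‖ ^ 2)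
        + β * ‖θloc i k - θ‖ ^ 2) :=
    Finset.sum_le_sum fun k _ => Finset.sum_le_sum fun i _ =>
      perturbed_sconv β μ hμ (ℓ i) (ℓ' i) (hsmooth i) (hsconv i) (θloc i k) θ θstar
  have hpos : 0 ≤ 1 / ((E : ℝ) * N) := by positivity
  refine (mul_le_mul_of_nonneg_left key hpos).trans (le_of_eq ?_)
  simp only [Finset.sum_add_distrib, Finset.sum_neg_distrib, ← Finset.mul_sum,
    Finset.sum_const, Finset.card_univ, Fintype.card_fin, nsmul_eq_mul]
  field_simp
end

section
/- Let H be a real inner product space, let N ≥ 2 and 1 ≤ m ≤ N be natural numbers, let v₁, …, v_N ∈ H, and let v̄ = (1/N)∑_{i=1}^N vᵢ. If S is a uniformly random m-element subset of {1, …, N}, then 𝔼_S[ ‖(1/m)∑_{i∈S} vᵢ − v̄‖² ] ≤ (1 − m/N) · (2/(mN)) · ∑_{i=1}^N ‖vᵢ‖². -/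
theorem swr_count_one (N m : ℕ) (hN : 2 ≤ N) (hm1 : 1 ≤ m) (i : Fin N) :
    (N : ℝ) * ((((Finset.univ : Finset (Fin N)).powersetCard m).filter
      (fun S => i ∈ S)).card : ℝ) = m * (N.choose m : ℝ) := by
  have h := Finset.card_filter_powersetCard_subset ({i} : Finset (Fin N)) Finset.univ m
    (by simp) (by simpa using hm1)
  simp only [Finset.singleton_subset_iff, Finset.card_univ, Fintype.card_fin,
    Finset.card_singleton] at h
  rw [h]
  obtain ⟨n, rfl⟩ := Nat.exists_eq_add_of_le' hN
  obtain ⟨k, rfl⟩ := Nat.exists_eq_add_of_le' hm1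
  have := Nat.add_one_mul_choose_eq (n+1) k
  simp only [show n + 2 - 1 = n + 1 by omega, Nat.add_sub_cancel]
  rw [mul_comm (((k+1 : ℕ)) : ℝ)]
  exact_mod_cast this

theorem swr_count_two (N m : ℕ) (hN : 2 ≤ N) (hm1 : 1 ≤ m) (i j : Fin N) (hij : i ≠ j) :
    (N : ℝ) * (N - 1) * ((((Finset.univ : Finset (Fin N)).powersetCard m).filter
      (fun S => i ∈ S ∧ j ∈ S)).card : ℝ) = m * (m - 1) * (N.choose m : ℝ) := by
  rcases Nat.lt_or_ge m 2 with hm | hm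
  · obtain rfl : m = 1 := by omega
    rw [Finset.filter_eq_empty_iff.2]
    · simp
    · rintro S hS ⟨h1, h2⟩
      rw [Finset.mem_powersetCard_univ] at hS
      exact hij (Finset.card_le_one.1 hS.le i h1 j h2)
  have h := Finset.card_filter_powersetCard_subset ({i, j} : Finset (Fin N)) Finset.univ m
    (by simp) (by rw [Finset.card_pair hij]; exact hm)
  simp only [Finset.insert_subset_iff, Finset.singleton_subset_iff, Finset.card_univ,
    Fintype.card_fin, Finset.card_pair hij] at h
  rw [h]
  obtain ⟨n, rfl⟩ := Nat.exists_eq_add_of_le' hN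
  obtain ⟨k, rfl⟩ := Nat.exists_eq_add_of_le' hm
  have h1 := Nat.add_one_mul_choose_eq (n+1) (k+1)
  have h2 := Nat.add_one_mul_choose_eq n k
  simp only [Nat.add_sub_cancel]
  have h1' : ((n:ℝ)+2) * ((n+1).choose (k+1)) = (n+2).choose (k+2) * (k+2) := by
    exact_mod_cast h1
  have h2' : ((n:ℝ)+1) * (n.choose k) = (n+1).choose (k+1) * (k+1) := by
    exact_mod_cast h2
  push_cast
  linear_combination ((n:ℝ)+2) * h2' + ((k:ℝ)+1) * h1'

theorem swr_sum_sq {H : Type*} [NormedAddCommGroup H] [InnerProductSpace ℝ H]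
    (N m : ℕ) (hN : 2 ≤ N) (hm1 : 1 ≤ m) (w : Fin N → H) (hw : ∑ i, w i = 0) :
    (N : ℝ) * (N - 1) * ∑ S ∈ (Finset.univ : Finset (Fin N)).powersetCard m,
      ‖∑ i ∈ S, w i‖ ^ 2 = m * (N - m) * (N.choose m : ℝ) * ∑ i, ‖w i‖ ^ 2 := by
  have e1 : ∀ S : Finset (Fin N), ‖∑ i ∈ S, w i‖ ^ 2 =
      ∑ i, ∑ j, if i ∈ S ∧ j ∈ S then inner ℝ (w i) (w j) else 0 := by
    intro S
    rw [← real_inner_self_eq_norm_sq, sum_inner]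
    simp_rw [inner_sum, ite_and]
    simp [Finset.sum_ite_mem, Finset.sum_ite_irrel]
  simp_rw [e1]
  rw [Finset.sum_comm, Finset.mul_sum, Finset.mul_sum]
  have hz : ∀ i, ∑ j, inner ℝ (w i) (w j) = 0 := by
    intro i; rw [← inner_sum, hw, inner_zero_right]
  refine Finset.sum_congr rfl fun i _ => ?_
  rw [Finset.sum_comm, Finset.mul_sum]
  have e2 : ∀ j, (N : ℝ) * (N - 1) * ∑ S ∈ (Finset.univ : Finset (Fin N)).powersetCard m,
      (if i ∈ S ∧ j ∈ S then inner ℝ (w i) (w j) else 0) =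
      m * (m - 1) * (N.choose m : ℝ) * inner ℝ (w i) (w j) +
      (if i = j then m * (N - m) * (N.choose m : ℝ) * inner ℝ (w i) (w j) else 0) := by
    intro j
    rw [← Finset.sum_filter, Finset.sum_const, nsmul_eq_mul]
    by_cases hij : i = j
    · subst hij
      have := swr_count_one N m hN hm1 i
      simp only [and_self, if_true]
      linear_combination ((N:ℝ) - 1) * inner ℝ (w i) (w i) * this
    · have := swr_count_two N m hN hm1 i j hij
      rw [if_neg hij]
      linear_combination inner ℝ (w i) (w j) * this
  simp_rw [e2]
  rw [Finset.sum_add_distrib, ← Finset.mul_sum, hz]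
  simp

/-- Sampling-without-replacement variance bound for a uniformly random
`m`-element subset of `{1, …, N}`. -/
theorem sampling_without_replacement_variance_bound
    {H : Type*} [NormedAddCommGroup H] [InnerProductSpace ℝ H]
    (N m : ℕ) (hN : 2 ≤ N) (hm1 : 1 ≤ m) (hmN : m ≤ N)
    (v : Fin N → H) (vbar : H) (hvbar : vbar = (N : ℝ)⁻¹ • ∑ i, v i) :
    (((Finset.univ : Finset (Fin N)).powersetCard m).card : ℝ)⁻¹ *
        ∑ S ∈ (Finset.univ : Finset (Fin N)).powersetCard m,
          ‖(m : ℝ)⁻¹ • ∑ i ∈ S, v i - vbar‖ ^ 2 ≤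
      (1 - (m : ℝ) / N) * (2 / ((m : ℝ) * N)) * ∑ i, ‖v i‖ ^ 2 := by
  have hNr : (2:ℝ) ≤ N := by exact_mod_cast hN
  have hmr : (1:ℝ) ≤ m := by exact_mod_cast hm1
  have hmNr : (m:ℝ) ≤ N := by exact_mod_cast hmN
  have hN0 : (N:ℝ) ≠ 0 := by positivity
  have hm0 : (m:ℝ) ≠ 0 := by positivity
  have hsv : ∑ i, v i = (N:ℝ) • vbar := by rw [hvbar, smul_inv_smul₀ hN0]
  have hw : ∑ i, (v i - vbar) = 0 := by
    simp [Finset.sum_sub_distrib, hsv, Nat.cast_smul_eq_nsmul]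
  have key := swr_sum_sq N m hN hm1 (fun i => v i - vbar) hw
  have hsq : ∑ i, ‖v i - vbar‖ ^ 2 ≤ ∑ i, ‖v i‖ ^ 2 := by
    have : ∑ i, ‖v i - vbar‖ ^ 2 = ∑ i, ‖v i‖ ^ 2 - N * ‖vbar‖ ^ 2 := by
      simp_rw [norm_sub_sq_real]
      rw [Finset.sum_add_distrib, Finset.sum_sub_distrib, ← Finset.mul_sum, ← sum_inner, hsv,
        real_inner_smul_left, real_inner_self_eq_norm_sq]
      simp
      ring
    rw [this]
    have : 0 ≤ (N:ℝ) * ‖vbar‖ ^ 2 := by positivity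
    linarith
  have hS : ∑ S ∈ (Finset.univ : Finset (Fin N)).powersetCard m,
      ‖(m : ℝ)⁻¹ • ∑ i ∈ S, v i - vbar‖ ^ 2 = ((m:ℝ)⁻¹) ^ 2 *
      ∑ S ∈ (Finset.univ : Finset (Fin N)).powersetCard m, ‖∑ i ∈ S, (v i - vbar)‖ ^ 2 := by
    rw [Finset.mul_sum]
    refine Finset.sum_congr rfl fun S hS => ?_
    rw [Finset.mem_powersetCard_univ] at hS
    have : (m : ℝ)⁻¹ • ∑ i ∈ S, v i - vbar = (m : ℝ)⁻¹ • ∑ i ∈ S, (v i - vbar) := by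
      rw [Finset.sum_sub_distrib, Finset.sum_const, hS, smul_sub,
        ← Nat.cast_smul_eq_nsmul ℝ, inv_smul_smul₀ hm0]
    rw [this, norm_smul, mul_pow, norm_inv, Real.norm_natCast]
  rw [hS, Finset.card_powersetCard, Finset.card_univ, Fintype.card_fin]
  have hC : (0:ℝ) < N.choose m := by exact_mod_cast Nat.choose_pos hmN
  have hN1 : (0:ℝ) < N - 1 := by linarith
  set T := ∑ S ∈ (Finset.univ : Finset (Fin N)).powersetCard m, ‖∑ i ∈ S, (v i - vbar)‖ ^ 2
  set W := ∑ i, ‖v i - vbar‖ ^ 2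
  set V := ∑ i, ‖v i‖ ^ 2
  have hW : 0 ≤ W := Finset.sum_nonneg fun i _ => by positivity
  have hT : T = m * (N - m) * (N.choose m : ℝ) * W / (N * (N - 1)) := by
    rw [eq_div_iff (by positivity)]; linarith
  have e : ((N.choose m : ℕ) : ℝ)⁻¹ * (((m:ℝ)⁻¹) ^ 2 * T) =
      (1 - (m:ℝ) / N) * (1 / (m * (N - 1))) * W := by
    rw [hT]; field_simp
  rw [e]
  have h1 : (m:ℝ) / N ≤ 1 := by rw [div_le_one (by positivity)]; exact hmNr
  have h2 : 1 / ((m:ℝ) * (N - 1)) ≤ 2 / (m * N) := by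
    rw [div_le_div_iff₀ (by positivity) (by positivity)]
    nlinarith
  have h3 : 0 ≤ 1 - (m:ℝ) / N := by linarith
  gcongr
end

section
/- Let H be a real inner product space, let ℓ : H → ℝ be differentiable with β-Lipschitz gradient (β > 0), let E ≥ 2 be a natural number and η > 0. Then for all x, θ ∈ H: ‖(x − η∇ℓ(x)) − θ‖² ≤ (1 + 1/(E−1) + 2Eη²β²)·‖x − θ‖² + 2Eη²·‖∇ℓ(θ)‖². -/
/-- Deterministic single-step drift recursion underlying the bounded-drift lemma. -/
theorem single_step_drift_recursion
    {H : Type*} [NormedAddCommGroup H] [InnerProductSpace ℝ H] [CompleteSpace H]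
    (ℓ : H → ℝ) (ℓ' : H → H) (β : ℝ) (hβ : 0 < β)
    (hdiff : ∀ x, HasGradientAt ℓ (ℓ' x) x)
    (hsmooth : ∀ u v, ‖ℓ' u - ℓ' v‖ ≤ β * ‖u - v‖)
    (E : ℕ) (hE : 2 ≤ E) (η : ℝ) (hη : 0 < η) (x θ : H) :
    ‖(x - η • ℓ' x) - θ‖ ^ 2 ≤
      (1 + 1 / ((E : ℝ) - 1) + 2 * E * η ^ 2 * β ^ 2) * ‖x - θ‖ ^ 2
        + 2 * E * η ^ 2 * ‖ℓ' θ‖ ^ 2 := by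
  have hE' : (2 : ℝ) ≤ E := by exact_mod_cast hE
  have ha : (0 : ℝ) < (E : ℝ) - 1 := by linarith
  have h1 : ‖(x - η • ℓ' x) - θ‖ ≤ ‖x - θ‖ + η * ‖ℓ' x‖ := by
    have h := norm_sub_le (x - θ) (η • ℓ' x)
    rw [norm_smul, Real.norm_of_nonneg hη.le] at h
    rwa [sub_right_comm]
  have h2 : ‖ℓ' x‖ ≤ β * ‖x - θ‖ + ‖ℓ' θ‖ := by
    have h := norm_add_le (ℓ' x - ℓ' θ) (ℓ' θ)
    rw [sub_add_cancel] at h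
    linarith [hsmooth x θ]
  have hg := norm_nonneg (ℓ' x)
  generalize ‖ℓ' x‖ = g at *
  generalize ‖ℓ' θ‖ = t at *
  generalize ‖x - θ‖ = d at *
  have h3 : ‖(x - η • ℓ' x) - θ‖ ^ 2 ≤ (d + η * g) ^ 2 :=
    pow_le_pow_left₀ (norm_nonneg _) h1 2
  have h4 : g ^ 2 ≤ 2 * β ^ 2 * d ^ 2 + 2 * t ^ 2 := by
    have h := pow_le_pow_left₀ hg h2 2
    nlinarith [sq_nonneg (β * d - t)]
  have h5 : (d + η * g) ^ 2 ≤ (1 + 1 / ((E : ℝ) - 1)) * d ^ 2 + E * η ^ 2 * g ^ 2 := by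
    have h : (1 + 1 / ((E : ℝ) - 1)) * d ^ 2 + E * η ^ 2 * g ^ 2 - (d + η * g) ^ 2
        = (d - ((E : ℝ) - 1) * (η * g)) ^ 2 / ((E : ℝ) - 1) := by
      field_simp
      ring
    have h' : 0 ≤ (d - ((E : ℝ) - 1) * (η * g)) ^ 2 / ((E : ℝ) - 1) := by positivity
    linarith
  have h6 : E * η ^ 2 * g ^ 2 ≤ E * η ^ 2 * (2 * β ^ 2 * d ^ 2 + 2 * t ^ 2) :=
    mul_le_mul_of_nonneg_left h4 (by positivity)
  linarith
end
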